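/- Let σ be a finite signature, A a valued σ-structure, and I a non-negative finite-valued σ-structure. Then Opt^BLP(I,A) equals the infimum over all integers m ≥ 1 of Opt(I, LP^m(A)); moreover, if this value is finite, the infimum is attained by some m ≥ 1. -/

import Mathlib

open scoped BigOperators Classical

namespace PVCSP

/-! ## Valued structures -/

/-- The value `Val(I,A,h)` of an assignment `h : I → A`, where the input structure is
given by weights `vI` and the template structure by costs `vA` (in `ℚ ∪ {∞}`). -/
def Val {σ : Type} [Fintype σ] (ar : σ → ℕ) {I A : Type} [Fintype I]
    (vI : ∀ R : σ, (Fin (ar R) → I) → ℚ)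
    (vA : ∀ R : σ, (Fin (ar R) → A) → WithTop ℚ) (h : I → A) : WithTop ℚ :=
  ∑ R : σ, ∑ v : Fin (ar R) → I, (vI R v : WithTop ℚ) * vA R (fun i => h (v i))

/-- `Opt(I,A)`: the minimum value over all assignments. -/
def Opt {σ : Type} [Fintype σ] (ar : σ → ℕ) {I A : Type} [Fintype I] [DecidableEq I]
    [Fintype A]
    (vI : ∀ R : σ, (Fin (ar R) → I) → ℚ)
    (vA : ∀ R : σ, (Fin (ar R) → A) → WithTop ℚ) : WithTop ℚ :=
  (Finset.univ : Finset (I → A)).inf fun h => Val ar vI vA h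

/-- Non-negativity of an input (finite-valued) structure. -/
def NNeg {σ : Type} (ar : σ → ℕ) {I : Type}
    (vI : ∀ R : σ, (Fin (ar R) → I) → ℚ) : Prop :=
  ∀ R v, 0 ≤ vI R v

/-- A fractional homomorphism from `A` to `B`. -/
def IsFracHom {σ : Type} [Fintype σ] (ar : σ → ℕ) {A B : Type}
    [Fintype A] [DecidableEq A] [Fintype B]
    (vA : ∀ R : σ, (Fin (ar R) → A) → WithTop ℚ)
    (vB : ∀ R : σ, (Fin (ar R) → B) → WithTop ℚ)
    (μ : (A → B) → ℚ) : Prop :=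
  (∀ f, 0 ≤ μ f) ∧ (∑ f : A → B, μ f = 1) ∧
    ∀ (R : σ) (a : Fin (ar R) → A),
      ∑ f : A → B, (μ f : WithTop ℚ) * vB R (fun i => f (a i)) ≤ vA R a

/-- A symmetric `n`-ary operation. -/
def IsSymmetricOp {A B : Type} {n : ℕ} (f : (Fin n → A) → B) : Prop :=
  ∀ (ρ : Equiv.Perm (Fin n)) (x : Fin n → A), f (fun i => x (ρ i)) = f x

/-- An `n`-ary fractional polymorphism of the pair `(A,B)`. -/
def IsFracPoly {σ : Type} [Fintype σ] (ar : σ → ℕ) {A B : Type}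
    [Fintype A] [DecidableEq A] [Fintype B]
    (vA : ∀ R : σ, (Fin (ar R) → A) → WithTop ℚ)
    (vB : ∀ R : σ, (Fin (ar R) → B) → WithTop ℚ)
    (n : ℕ) (ω : ((Fin n → A) → B) → ℚ) : Prop :=
  (∀ f, 0 ≤ ω f) ∧ (∑ f : (Fin n → A) → B, ω f = 1) ∧
    ∀ (R : σ) (a : Fin n → (Fin (ar R) → A)),
      ∑ f : (Fin n → A) → B, (ω f : WithTop ℚ) * vB R (fun j => f (fun i => a i j))
        ≤ ((((n : ℚ)⁻¹ : ℚ)) : WithTop ℚ) * ∑ i : Fin n, vA R (a i)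

/-- A dual fractional homomorphism from `I` to `J` (both non-negative finite-valued). -/
def IsDualFracHom {σ : Type} [Fintype σ] (ar : σ → ℕ) {I J : Type}
    [Fintype I] [DecidableEq I] [Fintype J] [DecidableEq J]
    (vI : ∀ R : σ, (Fin (ar R) → I) → ℚ)
    (vJ : ∀ R : σ, (Fin (ar R) → J) → ℚ)
    (η : (I → J) → ℚ) : Prop :=
  (∀ f, 0 ≤ η f) ∧ (∑ f : I → J, η f = 1) ∧
    ∀ (R : σ) (u : Fin (ar R) → J),
      ∑ f : I → J, η f *
          ∑ v ∈ Finset.univ.filter (fun v : Fin (ar R) → I => (fun i => f (v i)) = u), vI R v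
        ≤ vJ R u

/-! ## Linear programming relaxations -/

/-- Canonical embedding of `ℚ ∪ {∞}` into the extended reals. -/
noncomputable def toE (x : WithTop ℚ) : EReal :=
  x.recTopCoe ⊤ (fun q => ((q : ℝ) : EReal))

/-- The objective value of an LP solution `pc`. -/
def objVal {σ : Type} [Fintype σ] (ar : σ → ℕ) {I A : Type} [Fintype I] [Fintype A]
    (vI : ∀ R : σ, (Fin (ar R) → I) → ℚ)
    (vA : ∀ R : σ, (Fin (ar R) → A) → WithTop ℚ)
    (pc : ∀ R : σ, (Fin (ar R) → I) → (Fin (ar R) → A) → ℚ) : WithTop ℚ :=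
  ∑ R : σ, ∑ v : Fin (ar R) → I, ∑ a : Fin (ar R) → A,
    (pc R v a : WithTop ℚ) * ((vI R v : WithTop ℚ) * vA R a)

/-- Feasibility for the basic linear programming relaxation `BLP(I,A)`. -/
def BLPFeas {σ : Type} [Fintype σ] (ar : σ → ℕ) {I A : Type} [Fintype I] [Fintype A]
    [DecidableEq A]
    (vI : ∀ R : σ, (Fin (ar R) → I) → ℚ)
    (vA : ∀ R : σ, (Fin (ar R) → A) → WithTop ℚ)
    (pv : I → A → ℚ)
    (pc : ∀ R : σ, (Fin (ar R) → I) → (Fin (ar R) → A) → ℚ) : Prop :=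
  (∀ R v a, 0 < vI R v → 0 ≤ pc R v a) ∧
  (∀ u : I, ∑ a : A, pv u a = 1) ∧
  (∀ R v, 0 < vI R v → ∀ (i : Fin (ar R)) (a : A),
      pv (v i) a = ∑ t ∈ Finset.univ.filter (fun t : Fin (ar R) → A => t i = a), pc R v t) ∧
  (∀ R v, 0 < vI R v → ∀ t : Fin (ar R) → A, vA R t = ⊤ → pc R v t = 0)

/-- Feasibility for the Sherali–Adams relaxation `SA¹(I,A)`. -/
def SA1Feas {σ : Type} [Fintype σ] (ar : σ → ℕ) {I A : Type} [Fintype I] [Fintype A]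
    [DecidableEq A]
    (vI : ∀ R : σ, (Fin (ar R) → I) → ℚ)
    (vA : ∀ R : σ, (Fin (ar R) → A) → WithTop ℚ)
    (pv : I → A → ℚ)
    (pc : ∀ R : σ, (Fin (ar R) → I) → (Fin (ar R) → A) → ℚ) : Prop :=
  BLPFeas ar vI vA pv pc ∧
  (∀ R v, 0 < vI R v → ∀ t : Fin (ar R) → A,
      (∃ i j, v i = v j ∧ t i ≠ t j) → pc R v t = 0)

/-- The optimal value `Opt^BLP(I,A)` (equal to `⊤` if the program is infeasible). -/
noncomputable def OptBLP {σ : Type} [Fintype σ] (ar : σ → ℕ) {I A : Type}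
    [Fintype I] [Fintype A] [DecidableEq A]
    (vI : ∀ R : σ, (Fin (ar R) → I) → ℚ)
    (vA : ∀ R : σ, (Fin (ar R) → A) → WithTop ℚ) : EReal :=
  sInf { x : EReal | ∃ pv pc, BLPFeas ar vI vA pv pc ∧ x = toE (objVal ar vI vA pc) }

/-- The optimal value `Opt^{SA¹}(I,A)` (equal to `⊤` if the program is infeasible). -/
noncomputable def OptSA1 {σ : Type} [Fintype σ] (ar : σ → ℕ) {I A : Type}
    [Fintype I] [Fintype A] [DecidableEq A]
    (vI : ∀ R : σ, (Fin (ar R) → I) → ℚ)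
    (vA : ∀ R : σ, (Fin (ar R) → A) → WithTop ℚ) : EReal :=
  sInf { x : EReal | ∃ pv pc, SA1Feas ar vI vA pv pc ∧ x = toE (objVal ar vI vA pc) }

/-- The structure `LP^m(A)` on the universe of `m`-element multisets over `A`. -/
def lpPow {σ : Type} [Fintype σ] (ar : σ → ℕ) {A : Type} [Fintype A] [DecidableEq A]
    (m : ℕ) (vA : ∀ R : σ, (Fin (ar R) → A) → WithTop ℚ) :
    ∀ R : σ, (Fin (ar R) → Sym A m) → WithTop ℚ :=
  fun R s =>
    ((((m : ℚ)⁻¹ : ℚ)) : WithTop ℚ) *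
      ((Finset.univ.filter (fun t : Fin (ar R) → (Fin m → A) =>
          ∀ j, Multiset.map (t j) Finset.univ.val = Sym.toMultiset (s j))).inf
        (fun t => ∑ i : Fin m, vA R (fun j => t j i)))

/-! ## The graph of an input structure and iterated degrees -/

/-- Potential constraint vertices of the graph `G(I)`. -/
abbrev CVert (σ : Type) (ar : σ → ℕ) (I : Type) := Σ R : σ, (Fin (ar R) → I)

/-- The label of the edge between variable `u` and constraint `c`: the set of
coordinates of `c` at which `u` occurs. -/
def edgeLab {σ : Type} {ar : σ → ℕ} {I : Type} [DecidableEq I]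
    (u : I) (c : CVert σ ar I) : Finset ℕ :=
  (Finset.univ.filter (fun i : Fin (ar c.1) => c.2 i = u)).image Fin.val

/-- The type of `k`-th iterated degrees over signature `σ`. -/
def Deg (σ : Type) : ℕ → Type
  | 0 => Option (σ × ℚ)
  | k+1 => Multiset (Finset ℕ × Deg σ k)

/-- The `k`-th iterated degree of a vertex of `G(I)` (a variable or a constraint). -/
def degV {σ : Type} [Fintype σ] (ar : σ → ℕ) {I : Type} [Fintype I] [DecidableEq I]
    (vI : ∀ R : σ, (Fin (ar R) → I) → ℚ) :
    (k : ℕ) → (I ⊕ CVert σ ar I) → Deg σ k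
  | 0, Sum.inl _ => (none : Option (σ × ℚ))
  | 0, Sum.inr c => some (c.1, vI c.1 c.2)
  | k+1, Sum.inl u =>
      ((Finset.univ.filter
          (fun c : CVert σ ar I => 0 < vI c.1 c.2 ∧ ∃ i, c.2 i = u)).val).map
        (fun c => (edgeLab u c, degV ar vI k (Sum.inr c)))
  | k+1, Sum.inr c =>
      ((Finset.univ.filter (fun u : I => ∃ i, c.2 i = u)).val).map
        (fun u => (edgeLab u c, degV ar vI k (Sum.inl u)))

/-- The full iterated degree type. -/
def IterDeg (σ : Type) : Type := ∀ k : ℕ, Deg σ k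

/-- The iterated degree `δ(x)` of a vertex. -/
def itdeg {σ : Type} [Fintype σ] (ar : σ → ℕ) {I : Type} [Fintype I] [DecidableEq I]
    (vI : ∀ R : σ, (Fin (ar R) → I) → ℚ) (x : I ⊕ CVert σ ar I) : IterDeg σ :=
  fun k => degV ar vI k x

/-- The iterated degree sequence `δ(I)` (a multiset over all vertices of `G(I)`). -/
def degSeq {σ : Type} [Fintype σ] (ar : σ → ℕ) {I : Type} [Fintype I] [DecidableEq I]
    (vI : ∀ R : σ, (Fin (ar R) → I) → ℚ) : Multiset (IterDeg σ) :=
  (Finset.univ.val.map (fun u : I => itdeg ar vI (Sum.inl u))) +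
  ((Finset.univ.filter (fun c : CVert σ ar I => 0 < vI c.1 c.2)).val.map
      (fun c => itdeg ar vI (Sum.inr c)))

/-- Adjacency in the graph `G(I)`. -/
def Adj {σ : Type} (ar : σ → ℕ) {I : Type}
    (vI : ∀ R : σ, (Fin (ar R) → I) → ℚ) :
    (I ⊕ CVert σ ar I) → (I ⊕ CVert σ ar I) → Prop
  | Sum.inl u, Sum.inr c => 0 < vI c.1 c.2 ∧ ∃ i, c.2 i = u
  | Sum.inr c, Sum.inl u => 0 < vI c.1 c.2 ∧ ∃ i, c.2 i = u
  | _, _ => False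

/-- Actual vertices of `G(I)`: all variables and the positive-weight constraints. -/
def IsVert {σ : Type} (ar : σ → ℕ) {I : Type}
    (vI : ∀ R : σ, (Fin (ar R) → I) → ℚ) : (I ⊕ CVert σ ar I) → Prop
  | Sum.inl _ => True
  | Sum.inr c => 0 < vI c.1 c.2

/-- Connectedness of the input structure `I` (i.e. of its graph `G(I)`). -/
def Conn {σ : Type} (ar : σ → ℕ) {I : Type}
    (vI : ∀ R : σ, (Fin (ar R) → I) → ℚ) : Prop :=
  Nonempty I ∧ ∀ x y, IsVert ar vI x → IsVert ar vI y →
    Relation.ReflTransGen (Adj ar vI) x y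

/-- Weak congruence: `|J| ⬝ δ(I) = |I| ⬝ δ(J)`. -/
def WeakCongr {σ : Type} [Fintype σ] (ar : σ → ℕ) {I J : Type}
    [Fintype I] [DecidableEq I] [Fintype J] [DecidableEq J]
    (vI : ∀ R : σ, (Fin (ar R) → I) → ℚ)
    (vJ : ∀ R : σ, (Fin (ar R) → J) → ℚ) : Prop :=
  (Fintype.card J) • degSeq ar vI = (Fintype.card I) • degSeq ar vJ

/-- Membership of a variable in the connected component of the variable `x₀`. -/
def InComp {σ : Type} (ar : σ → ℕ) {I : Type}
    (vI : ∀ R : σ, (Fin (ar R) → I) → ℚ) (x₀ u : I) : Prop :=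
  Relation.ReflTransGen (Adj ar vI) (Sum.inl x₀) (Sum.inl u)


open Finset

/-- A linear program whose objective is bounded below on the recession cone attains its
minimum, over any ordered field; here over `ℚ`. -/
theorem exists_forall_le_of_linear_program {E J : Type*} [AddCommGroup E] [Module ℚ E]
    [Fintype J] (S : Set E) (W : Submodule ℚ E) (f : J → E →ₗ[ℚ] ℚ) (c : E →ₗ[ℚ] ℚ)
    (hsub : ∀ x ∈ S, ∀ y ∈ S, x - y ∈ W)
    (hadd : ∀ x ∈ S, ∀ d ∈ W, x + d ∈ S)
    (hc : ∀ d ∈ W, (∀ j, 0 ≤ f j d) → 0 ≤ c d)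
    (hne : ∃ x ∈ S, ∀ j, 0 ≤ f j x) :
    ∃ x ∈ S, (∀ j, 0 ≤ f j x) ∧ ∀ y ∈ S, (∀ j, 0 ≤ f j y) → c x ≤ c y := by
  let supp : E → Finset J := fun x => univ.filter fun j => f j x ≠ 0
  let basic : E → Prop := fun x => x ∈ S ∧ (∀ j, 0 ≤ f j x) ∧
    ∀ d ∈ W, (∀ j, f j x = 0 → f j d = 0) → ∀ j, f j d = 0
  have hred : ∀ n : ℕ, ∀ x ∈ S, (∀ j, 0 ≤ f j x) → (supp x).card = n →
      ∃ y, basic y ∧ c y ≤ c x := by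
    intro n
    induction n using Nat.strong_induction_on with
    | _ n ih =>
      intro x hx hfx hn
      by_cases hb : basic x
      · exact ⟨x, hb, le_rfl⟩
      obtain ⟨d, hdW, hd0, j₀, hj₀⟩ : ∃ d ∈ W, (∀ j, f j x = 0 → f j d = 0) ∧
          ∃ j, f j d ≠ 0 := by
        by_contra! h
        exact hb ⟨hx, hfx, h⟩
      obtain ⟨e, heW, he0, hce, j₁, hj₁⟩ : ∃ e ∈ W, (∀ j, f j x = 0 → f j e = 0) ∧
          c e ≤ 0 ∧ ∃ j, f j e < 0 := by
        have key : ∀ e ∈ W, c e < 0 → ∃ j, f j e < 0 := by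
          intro e he hce
          by_contra! h
          exact absurd (hc e he h) (not_le.2 hce)
        rcases lt_trichotomy (c d) 0 with h | h | h
        · exact ⟨d, hdW, hd0, h.le, key d hdW h⟩
        · rcases lt_or_gt_of_ne hj₀ with h' | h'
          · exact ⟨d, hdW, hd0, h.le, j₀, h'⟩
          · exact ⟨-d, W.neg_mem hdW, fun j hj => by simp [hd0 j hj], by simp [h],
              j₀, by simpa using h'⟩
        · exact ⟨-d, W.neg_mem hdW, fun j hj => by simp [hd0 j hj], by simpa using h.le,
            key _ (W.neg_mem hdW) (by simpa using h)⟩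
      obtain ⟨k, hk, hmin⟩ := exists_min_image (univ.filter fun j => f j e < 0)
        (fun j => f j x / (- f j e)) ⟨j₁, by simpa using hj₁⟩
      have hk' : f k e < 0 := by simpa using hk
      set t := f k x / (- f k e) with ht
      have ht0 : 0 ≤ t := div_nonneg (hfx k) (by linarith)
      have hyS : x + t • e ∈ S := hadd x hx _ (W.smul_mem t heW)
      have hfy : ∀ j, 0 ≤ f j (x + t • e) := by
        intro j
        simp only [map_add, map_smul, smul_eq_mul]
        rcases lt_or_ge (f j e) 0 with h | h
        · have h1 := hmin j (by simpa using h)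
          rw [le_div_iff₀ (by linarith)] at h1
          linarith
        · have := hfx j
          positivity
      have hk0 : f k (x + t • e) = 0 := by
        simp only [map_add, map_smul, smul_eq_mul, ht]
        field_simp [hk'.ne]
        ring
      have hlt : (supp (x + t • e)).card < n := by
        rw [← hn]
        refine card_lt_card ((ssubset_iff_of_subset ?_).2 ⟨k, ?_, ?_⟩)
        · intro j
          simp only [supp, mem_filter, mem_univ, true_and]
          contrapose!
          intro h
          simp [h, he0 j h]
        · simp only [supp, mem_filter, mem_univ, true_and]
          exact fun h => hk'.ne (he0 k h)
        · simpa only [supp, mem_filter, mem_univ, true_and, not_not] using hk0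
      obtain ⟨y, hy, hcy⟩ := ih _ hlt _ hyS hfy rfl
      refine ⟨y, hy, hcy.trans ?_⟩
      simp only [map_add, map_smul, smul_eq_mul]
      nlinarith
  have hval : ∀ x y, basic x → basic y → supp x = supp y → c x = c y := by
    intro x y hx hy hxy
    have hz : ∀ j, f j x = 0 ↔ f j y = 0 := by
      intro j
      have := congrArg (fun s => j ∈ s) hxy
      simpa [supp, not_iff_not] using this
    have hW := hsub x hx.1 y hy.1
    have h0 := hx.2.2 _ hW fun j hj => by simp [hj, (hz j).1 hj]
    have h1 := hc _ hW fun j => (h0 j).ge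
    have h2 := hc _ (W.neg_mem hW) fun j => by rw [map_neg, h0 j, neg_zero]
    simp only [map_neg, map_sub] at h1 h2
    linarith
  have hfin : (c '' {x | basic x}).Finite := by
    refine Set.Finite.of_finite_image (f := fun q => {s | ∃ x, basic x ∧ c x = q ∧ supp x = s})
      (Set.toFinite _) ?_
    rintro _ ⟨x, hx, rfl⟩ _ ⟨y, hy, rfl⟩ h
    have : supp x ∈ {s | ∃ z, basic z ∧ c z = c y ∧ supp z = s} := by
      exact (Set.ext_iff.1 h _).1 ⟨x, hx, rfl, rfl⟩
    obtain ⟨z, hz, hzy, hzx⟩ := this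
    rw [← hzy, hval x z hx hz hzx.symm]
  obtain ⟨x₀, hx₀, hfx₀⟩ := hne
  obtain ⟨y₀, hy₀, -⟩ := hred _ x₀ hx₀ hfx₀ rfl
  obtain ⟨_, ⟨x, hx, rfl⟩, hmin⟩ := Set.exists_min_image _ id hfin ⟨_, y₀, hy₀, rfl⟩
  refine ⟨x, hx.1, hx.2.1, fun y hy hfy => ?_⟩
  obtain ⟨z, hz, hzy⟩ := hred _ y hy hfy rfl
  exact (hmin _ ⟨z, hz, rfl⟩).trans hzy

theorem sum_map_eq_coe {B : Type*} [Fintype B] [DecidableEq B] {w : B → WithTop ℚ}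
    (M : Multiset B) (h : ∀ t ∈ M, w t ≠ ⊤) :
    (M.map w).sum = ((∑ t, (M.count t : ℚ) * (w t).untopD 0 : ℚ) : WithTop ℚ) := by
  have h1 : M.map (w) = (M.map fun t => (w t).untopD 0).map ((↑) : ℚ → WithTop ℚ) := by
    rw [Multiset.map_map]
    refine Multiset.map_congr rfl fun t ht => ?_
    obtain ⟨q, hq⟩ := WithTop.ne_top_iff_exists.1 (h t ht)
    simp [← hq]
  have h2 : ∀ N : Multiset ℚ, (N.map ((↑) : ℚ → WithTop ℚ)).sum = ((N.sum : ℚ) : WithTop ℚ) := by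
    intro N
    induction N using Multiset.induction_on with
    | empty => simp
    | cons a N ih => simp [ih]
  rw [h1, h2, Finset.sum_multiset_map_count]
  congr 1
  rw [← Finset.sum_subset (subset_univ M.toFinset)]
  · refine sum_congr rfl fun t _ => by rw [nsmul_eq_mul]
  · intro t _ ht
    simp [Multiset.count_eq_zero.2 (fun h => ht (Multiset.mem_toFinset.2 h))]

section

variable {σ : Type} [Fintype σ] {ar : σ → ℕ} {A : Type} [Fintype A] [DecidableEq A]
  {vA : ∀ R : σ, (Fin (ar R) → A) → WithTop ℚ} {m : ℕ}

theorem lpPow_le_of_multiset {R : σ} {s : Fin (ar R) → Sym A m}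
    (M : Multiset (Fin (ar R) → A)) (hM : M.card = m)
    (hs : ∀ j, M.map (fun t => t j) = (s j : Multiset A)) :
    lpPow ar m vA R s ≤ (((m : ℚ)⁻¹ : ℚ) : WithTop ℚ) * (M.map (vA R)).sum := by
  obtain ⟨e, rfl⟩ : ∃ e : Fin m → Fin (ar R) → A, M = univ.val.map e := by
    subst hM
    induction M using Quotient.inductionOn with
    | _ l => exact ⟨l.get, ((Fin.univ_val_map l.get).trans (by rw [List.ofFn_get]; rfl)).symm⟩
  unfold lpPow
  have : ∀ x y : WithTop ℚ, x ≤ y →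
      (((m : ℚ)⁻¹ : ℚ) : WithTop ℚ) * x ≤ (((m : ℚ)⁻¹ : ℚ) : WithTop ℚ) * y := by
    intro x y hxy
    rcases Nat.eq_zero_or_pos m with rfl | hm
    · simp
    have hpos : 0 < (m : ℚ)⁻¹ := by positivity
    induction y using WithTop.recTopCoe with
    | top =>
      rw [WithTop.mul_top (by exact_mod_cast hpos.ne')]
      exact le_top
    | coe q =>
      obtain ⟨p, rfl, hpq⟩ := WithTop.le_coe_iff.1 hxy
      exact_mod_cast mul_le_mul_of_nonneg_left hpq hpos.le
  apply this
  refine (Finset.inf_le (b := fun j i => e i j) ?_).trans ?_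
  · simp only [mem_filter, mem_univ, true_and]
    intro j
    rw [← hs j, Multiset.map_map]
    rfl
  · rw [Multiset.map_map]
    exact le_rfl

theorem exists_multiset_of_lpPow_ne_top (hm : 1 ≤ m) {R : σ} {s : Fin (ar R) → Sym A m}
    (h : lpPow ar m vA R s ≠ ⊤) :
    ∃ M : Multiset (Fin (ar R) → A), M.card = m ∧
      (∀ j, M.map (fun t => t j) = (s j : Multiset A)) ∧ (∀ t ∈ M, vA R t ≠ ⊤) ∧
      lpPow ar m vA R s = (((m : ℚ)⁻¹ : ℚ) : WithTop ℚ) * (M.map (vA R)).sum := by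
  unfold lpPow at h ⊢
  have hm0 : (((m : ℚ)⁻¹ : ℚ) : WithTop ℚ) ≠ 0 := by
    have : (m : ℚ)⁻¹ ≠ 0 := by positivity
    exact_mod_cast this
  have hinf : ((Finset.univ.filter (fun t : Fin (ar R) → (Fin m → A) =>
          ∀ j, Multiset.map (t j) Finset.univ.val = Sym.toMultiset (s j))).inf
        (fun t => ∑ i : Fin m, vA R (fun j => t j i))) ≠ ⊤ := by
    intro h'
    rw [h'] at h
    exact h (WithTop.mul_top hm0)
  have hne : (Finset.univ.filter (fun t : Fin (ar R) → (Fin m → A) =>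
          ∀ j, Multiset.map (t j) Finset.univ.val = Sym.toMultiset (s j))).Nonempty := by
    rw [nonempty_iff_ne_empty]
    intro h'
    rw [h'] at hinf
    exact hinf inf_empty
  obtain ⟨t, ht, hteq⟩ := exists_mem_eq_inf _ hne
    (fun t : Fin (ar R) → (Fin m → A) => ∑ i : Fin m, vA R (fun j => t j i))
  rw [hteq] at hinf ⊢
  refine ⟨univ.val.map fun i j => t j i, by simp, fun j => ?_, ?_, ?_⟩
  · rw [Multiset.map_map]
    exact (mem_filter.1 ht).2 j
  · intro u hu
    obtain ⟨i, -, rfl⟩ := Multiset.mem_map.1 hu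
    exact (WithTop.sum_ne_top.1 hinf) i (mem_univ i)
  · rw [Multiset.map_map]
    rfl

end

theorem count_map_eval {ι A : Type*} [Fintype ι] [DecidableEq ι] [Fintype A] [DecidableEq A]
    (M : Multiset (ι → A)) (i : ι) (a : A) :
    (M.map fun t => t i).count a = ∑ t ∈ univ.filter (fun t : ι → A => t i = a), M.count t := by
  induction M using Multiset.induction_on with
  | empty => simp
  | cons t M ih =>
    simp [Multiset.count_cons, sum_add_distrib, ih, eq_comm]

theorem exists_common_denominator {ι : Type*} [Fintype ι] (q : ι → ℚ) :
    ∃ m : ℕ, 1 ≤ m ∧ ∃ n : ι → ℕ, ∀ i, 0 ≤ q i → q i * m = n i := by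
  have hpos : 0 < ∏ i, (q i).den := prod_pos fun i _ => (q i).den_pos
  refine ⟨∏ i, (q i).den, hpos, fun i => (q i * (∏ i, (q i).den : ℕ)).num.toNat, fun i hi => ?_⟩
  obtain ⟨k, hk⟩ := dvd_prod_of_mem (fun i => (q i).den) (mem_univ i)
  have h : q i * (∏ i, (q i).den : ℕ) = (((q i).num * k : ℤ) : ℚ) := by
    rw [hk]
    push_cast
    rw [← mul_assoc, Rat.mul_den_eq_num]
  have h0 : 0 ≤ (q i).num * (k : ℤ) := mul_nonneg (Rat.num_nonneg.2 hi) (by positivity)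
  simp only [h, Rat.num_intCast]
  exact_mod_cast (Int.toNat_of_nonneg h0).symm

section

variable {σ : Type} [Fintype σ] {ar : σ → ℕ} {A : Type} [Fintype A] [DecidableEq A]
  {vA : ∀ R : σ, (Fin (ar R) → A) → WithTop ℚ} {I : Type} [Fintype I]
  {vI : ∀ R : σ, (Fin (ar R) → I) → ℚ}
  {pv : I → A → ℚ} {pc : ∀ R : σ, (Fin (ar R) → I) → (Fin (ar R) → A) → ℚ}

theorem BLPFeas.objVal_eq (hp : BLPFeas ar vI vA pv pc) (hnn : NNeg ar vI) :
    objVal ar vI vA pc =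
      ((∑ R, ∑ v, ∑ t, pc R v t * (vI R v * (vA R t).untopD 0) : ℚ) : WithTop ℚ) := by
  unfold objVal
  simp only [WithTop.coe_sum]
  refine sum_congr rfl fun R _ => sum_congr rfl fun v _ => sum_congr rfl fun t _ => ?_
  rcases (hnn R v).eq_or_lt with h | h
  · simp [← h]
  · by_cases ht : vA R t = ⊤
    · simp [hp.2.2.2 R v h t ht]
    · obtain ⟨q, hq⟩ := WithTop.ne_top_iff_exists.1 ht
      simp [← hq]

theorem exists_BLPFeas_of_Val_ne_top {m : ℕ} (hm : 1 ≤ m) (hnn : NNeg ar vI)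
    (h : I → Sym A m) (hV : Val ar vI (lpPow ar m vA) h ≠ ⊤) :
    ∃ pv pc, BLPFeas ar vI vA pv pc ∧ objVal ar vI vA pc = Val ar vI (lpPow ar m vA) h := by
  have hm0 : (m : ℚ) ≠ 0 := by positivity
  have hfin : ∀ R v, 0 < vI R v → lpPow ar m vA R (fun i => h (v i)) ≠ ⊤ := by
    intro R v hv htop
    have h1 := WithTop.sum_ne_top.1 (WithTop.sum_ne_top.1 hV R (mem_univ R)) v (mem_univ v)
    rw [htop] at h1
    exact h1 (WithTop.mul_top (by exact_mod_cast hv.ne'))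
  have hM : ∀ R v, ∃ M : Multiset (Fin (ar R) → A), 0 < vI R v → M.card = m ∧
      (∀ j, M.map (fun t => t j) = (h (v j) : Multiset A)) ∧ (∀ t ∈ M, vA R t ≠ ⊤) ∧
      lpPow ar m vA R (fun i => h (v i)) =
        (((m : ℚ)⁻¹ : ℚ) : WithTop ℚ) * (M.map (vA R)).sum := by
    intro R v
    by_cases hv : 0 < vI R v
    · obtain ⟨M, hM⟩ := exists_multiset_of_lpPow_ne_top hm (hfin R v hv)
      exact ⟨M, fun _ => hM⟩
    · exact ⟨0, fun h => absurd h hv⟩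
  choose M hM using hM
  have hfeas : BLPFeas ar vI vA (fun u a => ((h u : Multiset A).count a : ℚ) / m)
      (fun R v t => ((M R v).count t : ℚ) / m) := by
    refine ⟨fun R v a _ => by positivity, fun u => ?_, fun R v hv i a => ?_,
      fun R v hv t ht => ?_⟩
    · rw [← sum_div, ← Nat.cast_sum, Multiset.sum_count_eq_card (fun a _ => mem_univ a)]
      simp [hm0]
    · dsimp only
      rw [← sum_div, ← Nat.cast_sum, ← (hM R v hv).2.1 i, count_map_eval]
    · dsimp only
      rw [Multiset.count_eq_zero.2 fun hmem => (hM R v hv).2.2.1 t hmem ht]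
      simp
  refine ⟨_, _, hfeas, ?_⟩
  rw [hfeas.objVal_eq hnn]
  unfold Val
  simp only [WithTop.coe_sum]
  refine sum_congr rfl fun R _ => sum_congr rfl fun v _ => ?_
  rw [← WithTop.coe_sum]
  rcases (hnn R v).eq_or_lt with hv | hv
  · simp [← hv]
  · rw [(hM R v hv).2.2.2, sum_map_eq_coe _ (hM R v hv).2.2.1, ← WithTop.coe_mul,
      ← WithTop.coe_mul, mul_sum, mul_sum]
    congr 1
    refine sum_congr rfl fun t _ => by ring

theorem BLPFeas.exists_Val_le (har : ∀ R, 0 < ar R) (hnn : NNeg ar vI)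
    (hp : BLPFeas ar vI vA pv pc) :
    ∃ m : ℕ, 1 ≤ m ∧ ∃ h : I → Sym A m,
      Val ar vI (lpPow ar m vA) h ≤ objVal ar vI vA pc := by
  obtain ⟨m, hm, n, hn⟩ := exists_common_denominator
    (fun x : Σ R : σ, (Fin (ar R) → I) × (Fin (ar R) → A) => pc x.1 x.2.1 x.2.2)
  have hm0 : (m : ℚ) ≠ 0 := by positivity
  let M : ∀ R : σ, (Fin (ar R) → I) → Multiset (Fin (ar R) → A) :=
    fun R v => ∑ t, n ⟨R, v, t⟩ • {t}
  have hcount : ∀ R v t, (M R v).count t = n ⟨R, v, t⟩ := by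
    intro R v t
    simp [M, Multiset.count_sum', Multiset.count_singleton]
  have hpc : ∀ R v t, 0 < vI R v → pc R v t = ((M R v).count t : ℚ) / m := by
    intro R v t hv
    rw [hcount, ← hn ⟨R, v, t⟩ (hp.1 R v t hv)]
    field_simp
  have hmap : ∀ R v, 0 < vI R v → ∀ i a,
      (((M R v).map fun t => t i).count a : ℚ) = pv (v i) a * m := by
    intro R v hv i a
    rw [hp.2.2.1 R v hv i a, count_map_eval, sum_mul, Nat.cast_sum]
    refine sum_congr rfl fun t _ => ?_
    rw [hpc R v t hv]
    field_simp
  have hcard : ∀ R v, 0 < vI R v → (M R v).card = m := by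
    intro R v hv
    have h1 := Multiset.sum_count_eq_card (s := univ)
      (m := (M R v).map fun t => t ⟨0, har R⟩) (fun a _ => mem_univ a)
    rw [Multiset.card_map] at h1
    rw [← h1, ← Nat.cast_inj (R := ℚ), Nat.cast_sum]
    simp only [hmap R v hv, ← sum_mul, hp.2.1, one_mul]
  have hh : ∀ u, ∃ s : Sym A m, ∀ R v, 0 < vI R v → ∀ i, v i = u →
      (M R v).map (fun t => t i) = (s : Multiset A) := by
    intro u
    by_cases hu : ∃ R v, 0 < vI R v ∧ ∃ i, v i = u
    · obtain ⟨R, v, hv, i, rfl⟩ := hu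
      refine ⟨⟨(M R v).map fun t => t i, by rw [Multiset.card_map, hcard R v hv]⟩, ?_⟩
      intro R' v' hv' i' hi'
      refine Multiset.ext.2 fun a => ?_
      rw [← Nat.cast_inj (R := ℚ), hmap R' v' hv', hi', ← hmap R v hv]
      rfl
    · push Not at hu
      obtain ⟨a, -, -⟩ := exists_ne_zero_of_sum_ne_zero
        (show ∑ a, pv u a ≠ 0 by rw [hp.2.1]; exact one_ne_zero)
      exact ⟨Sym.replicate m a, fun R v hv i hi => absurd hi (hu R v hv i)⟩
  choose h hh using hh
  refine ⟨m, hm, h, ?_⟩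
  rw [hp.objVal_eq hnn]
  unfold Val
  simp only [WithTop.coe_sum]
  refine sum_le_sum fun R _ => sum_le_sum fun v _ => ?_
  rw [← WithTop.coe_sum]
  rcases (hnn R v).eq_or_lt with hv | hv
  · simp [← hv]
  · have htop : ∀ t ∈ M R v, vA R t ≠ ⊤ := by
      intro t ht htop
      have h1 := hp.2.2.2 R v hv t htop
      rw [hpc R v t hv, div_eq_zero_iff, Nat.cast_eq_zero, Multiset.count_eq_zero] at h1
      exact h1.elim (fun h => h ht) hm0
    have hle := lpPow_le_of_multiset (vA := vA) (s := fun i => h (v i)) (M R v) (hcard R v hv)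
      fun j => hh (v j) R v hv j rfl
    rw [sum_map_eq_coe _ htop, ← WithTop.coe_mul] at hle
    obtain ⟨q, hq, hle⟩ := WithTop.le_coe_iff.1 hle
    rw [hq, ← WithTop.coe_mul, WithTop.coe_le_coe]
    refine (mul_le_mul_of_nonneg_left hle hv.le).trans (le_of_eq ?_)
    rw [mul_sum, mul_sum]
    refine sum_congr rfl fun t _ => ?_
    rw [hpc R v t hv]
    ring

theorem exists_BLPFeas_forall_objVal_le (har : ∀ R, 0 < ar R) (hnn : NNeg ar vI)
    (hp : BLPFeas ar vI vA pv pc) :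
    ∃ pv' pc', BLPFeas ar vI vA pv' pc' ∧ ∀ qv qc, BLPFeas ar vI vA qv qc →
      objVal ar vI vA pc' ≤ objVal ar vI vA qc := by
  let J := {x : Σ R : σ, (Fin (ar R) → I) × (Fin (ar R) → A) // 0 < vI x.1 x.2.1}
  let f : J →
      ((I → A → ℚ) × (∀ R : σ, (Fin (ar R) → I) → (Fin (ar R) → A) → ℚ)) →ₗ[ℚ] ℚ := fun x =>
    { toFun := fun p => p.2 x.1.1 x.1.2.1 x.1.2.2
      map_add' := fun _ _ => rfl
      map_smul' := fun _ _ => rfl }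
  let c : ((I → A → ℚ) × (∀ R : σ, (Fin (ar R) → I) → (Fin (ar R) → A) → ℚ)) →ₗ[ℚ] ℚ :=
    { toFun := fun p => ∑ R, ∑ v, ∑ t, p.2 R v t * (vI R v * (vA R t).untopD 0)
      map_add' := fun p q => by simp [add_mul, sum_add_distrib]
      map_smul' := fun r p => by simp [mul_assoc, mul_sum] }
  let S : Set ((I → A → ℚ) × (∀ R : σ, (Fin (ar R) → I) → (Fin (ar R) → A) → ℚ)) := {p | (∀ u : I, ∑ a : A, p.1 u a = 1) ∧
    (∀ R v, 0 < vI R v → ∀ (i : Fin (ar R)) (a : A),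
      p.1 (v i) a = ∑ t ∈ univ.filter (fun t : Fin (ar R) → A => t i = a), p.2 R v t) ∧
    (∀ R v, 0 < vI R v → ∀ t : Fin (ar R) → A, vA R t = ⊤ → p.2 R v t = 0)}
  let W : Submodule ℚ ((I → A → ℚ) × (∀ R : σ, (Fin (ar R) → I) → (Fin (ar R) → A) → ℚ)) :=
    { carrier := {p | (∀ u : I, ∑ a : A, p.1 u a = 0) ∧
        (∀ R v, 0 < vI R v → ∀ (i : Fin (ar R)) (a : A),
          p.1 (v i) a = ∑ t ∈ univ.filter (fun t : Fin (ar R) → A => t i = a), p.2 R v t) ∧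
        (∀ R v, 0 < vI R v → ∀ t : Fin (ar R) → A, vA R t = ⊤ → p.2 R v t = 0)}
      zero_mem' := by simp
      add_mem' := by
        rintro p q ⟨hp1, hp2, hp3⟩ ⟨hq1, hq2, hq3⟩
        refine ⟨fun u => ?_, fun R v hv i a => ?_, fun R v hv t ht => ?_⟩
        · simp [sum_add_distrib, hp1, hq1]
        · simp [sum_add_distrib, hp2 R v hv, hq2 R v hv]
        · simp [hp3 R v hv t ht, hq3 R v hv t ht]
      smul_mem' := by
        rintro r p ⟨hp1, hp2, hp3⟩
        refine ⟨fun u => ?_, fun R v hv i a => ?_, fun R v hv t ht => ?_⟩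
        · simp [← mul_sum, hp1]
        · simp [← mul_sum, hp2 R v hv]
        · simp [hp3 R v hv t ht] }
  obtain ⟨x, hxS, hx0, hmin⟩ := exists_forall_le_of_linear_program S W f c
    (by
      rintro p ⟨hp1, hp2, hp3⟩ q ⟨hq1, hq2, hq3⟩
      refine ⟨fun u => ?_, fun R v hv i a => ?_, fun R v hv t ht => ?_⟩
      · simp [sum_sub_distrib, hp1, hq1]
      · simp [sum_sub_distrib, hp2 R v hv, hq2 R v hv]
      · simp [hp3 R v hv t ht, hq3 R v hv t ht])
    (by
      rintro p ⟨hp1, hp2, hp3⟩ q ⟨hq1, hq2, hq3⟩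
      refine ⟨fun u => ?_, fun R v hv i a => ?_, fun R v hv t ht => ?_⟩
      · simp [sum_add_distrib, hp1, hq1]
      · simp [sum_add_distrib, hp2 R v hv, hq2 R v hv]
      · simp [hp3 R v hv t ht, hq3 R v hv t ht])
    (by
      rintro d ⟨hd1, hd2, -⟩ hd
      refine (sum_eq_zero fun R _ => sum_eq_zero fun v _ => sum_eq_zero fun t _ => ?_).ge
      rcases (hnn R v).eq_or_lt with hv | hv
      · simp [← hv]
      · have h1 : ∑ t, d.2 R v t = 0 := by
          rw [← hd1 (v ⟨0, har R⟩)]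
          simp only [hd2 R v hv]
          exact (sum_fiberwise _ _ _).symm
        have h2 := (sum_eq_zero_iff_of_nonneg fun t _ => hd ⟨⟨R, v, t⟩, hv⟩).1 h1 t (mem_univ t)
        exact mul_eq_zero_of_left h2 _)
    ⟨(pv, pc), hp.2, fun j => hp.1 _ _ _ j.2⟩
  have hx : BLPFeas ar vI vA x.1 x.2 := ⟨fun R v t hv => hx0 ⟨⟨R, v, t⟩, hv⟩, hxS⟩
  refine ⟨x.1, x.2, hx, fun qv qc hq => ?_⟩
  rw [hx.objVal_eq hnn, hq.objVal_eq hnn, WithTop.coe_le_coe]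
  exact hmin (qv, qc) hq.2 fun j => hq.1 _ _ _ j.2

end

theorem toE_mono : Monotone toE := by
  intro x y hxy
  induction y using WithTop.recTopCoe with
  | top => exact le_top
  | coe q =>
    obtain ⟨p, rfl, hpq⟩ := WithTop.le_coe_iff.1 hxy
    exact EReal.coe_le_coe_iff.2 (by exact_mod_cast hpq)

theorem stmt_3 {σ : Type} [Fintype σ] (ar : σ → ℕ) (har : ∀ R, 0 < ar R)
    {A : Type} [Fintype A] [DecidableEq A]
    (vA : ∀ R : σ, (Fin (ar R) → A) → WithTop ℚ)
    {I : Type} [Fintype I] [DecidableEq I]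
    (vI : ∀ R : σ, (Fin (ar R) → I) → ℚ) (hnn : NNeg ar vI) :
    (OptBLP ar vI vA = ⨅ m : {m : ℕ // 1 ≤ m}, toE (Opt ar vI (lpPow ar m.1 vA))) ∧
    ((OptBLP ar vI vA ≠ ⊤ ∧ OptBLP ar vI vA ≠ ⊥) →
      ∃ m : ℕ, 1 ≤ m ∧ toE (Opt ar vI (lpPow ar m vA)) = OptBLP ar vI vA) := by
  have hlow : ∀ m : ℕ, 1 ≤ m → OptBLP ar vI vA ≤ toE (Opt ar vI (lpPow ar m vA)) := by
    intro m hm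
    by_cases htop : Opt ar vI (lpPow ar m vA) = ⊤
    · rw [htop]
      exact le_top
    · have hne : (univ : Finset (I → Sym A m)).Nonempty := by
        rw [nonempty_iff_ne_empty]
        intro h
        exact htop (by rw [Opt, h, inf_empty])
      obtain ⟨h, -, hh⟩ := exists_mem_eq_inf univ hne fun h => Val ar vI (lpPow ar m vA) h
      obtain ⟨pv, pc, hfeas, hobj⟩ := exists_BLPFeas_of_Val_ne_top hm hnn h (by rwa [Opt, hh] at htop)
      exact sInf_le ⟨pv, pc, hfeas, by rw [hobj, Opt, hh]⟩
  have hup : ∀ pv pc, BLPFeas ar vI vA pv pc →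
      ∃ m : ℕ, 1 ≤ m ∧ toE (Opt ar vI (lpPow ar m vA)) ≤ toE (objVal ar vI vA pc) := by
    intro pv pc hp
    obtain ⟨m, hm, h, hle⟩ := hp.exists_Val_le har hnn
    refine ⟨m, hm, toE_mono (le_trans ?_ hle)⟩
    exact Finset.inf_le (f := fun h => Val ar vI (lpPow ar m vA) h) (mem_univ h)
  refine ⟨le_antisymm (le_iInf fun m => hlow m.1 m.2) (le_sInf ?_), fun hfin => ?_⟩
  · rintro _ ⟨pv, pc, hp, rfl⟩
    obtain ⟨m, hm, hle⟩ := hup pv pc hp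
    refine le_trans ?_ hle
    exact iInf_le (fun m : {m : ℕ // 1 ≤ m} => toE (Opt ar vI (lpPow ar m.1 vA))) ⟨m, hm⟩
  · obtain ⟨pv, pc, hp⟩ : ∃ pv pc, BLPFeas ar vI vA pv pc := by
      by_contra! h
      exact hfin.1 (sInf_eq_top.2 fun x ⟨pv, pc, hp, _⟩ => absurd hp (h pv pc))
    obtain ⟨pv', pc', hp', hmin⟩ := exists_BLPFeas_forall_objVal_le har hnn hp
    obtain ⟨m, hm, hle⟩ := hup pv' pc' hp'
    refine ⟨m, hm, le_antisymm (hle.trans (le_sInf ?_)) (hlow m hm)⟩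
    rintro _ ⟨qv, qc, hq, rfl⟩
    exact toE_mono (hmin qv qc hq)

end PVCSP
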